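/- arXiv:1509.01033 — 2 statements merged into one kernel-verified Lean document; each statement's English description precedes it below -/
import Mathlib

section
/- For every n ≥ 2 there is a group homomorphism P_n : W(C̃_n) → W(C̃_{n+1}) determined on Coxeter generators by σ_i ↦ σ_i for 0 ≤ i ≤ n−1 and t_n ↦ σ_n t_{n+1} σ_n, and this homomorphism is injective. -/
open List

/-- The Coxeter matrix of affine type C̃ with `m+1` generators indexed `0, …, m`:
the bond `{0,1}` has order `4`, the bonds `{i,i+1}` for `1 ≤ i ≤ m-2` have order `3`,
the bond `{m-1,m}` has order `4`, and all other pairs commute.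
With the paper's notation, `(ctildeM n).Group` is `W(C̃ₙ)`, where the generator of index
`i ≤ n-1` is `σᵢ` and the generator of index `n` is `tₙ`. -/
def ctildeM (m : ℕ) : CoxeterMatrix (Fin (m+1)) where
  M := Matrix.of fun i j =>
    if i = j then 1
    else if (i:ℕ)+1 < (j:ℕ) ∨ (j:ℕ)+1 < (i:ℕ) then 2
    else if (i:ℕ) = 0 ∨ (j:ℕ) = 0 ∨ (i:ℕ) = m ∨ (j:ℕ) = m then 4
    else 3
  isSymm := by
    unfold Matrix.IsSymm
    ext i j
    simp only [Matrix.transpose_apply, Matrix.of_apply]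
    rcases eq_or_ne i j with h | h
    · simp [h]
    · rw [if_neg h, if_neg (Ne.symm h)]
      exact if_congr (by omega) rfl (if_congr (by tauto) rfl rfl)
  diagonal := fun i => by simp
  off_diagonal := fun i i' h => by
    simp only [Matrix.of_apply, if_neg h]
    split <;> simp_all <;> split <;> simp_all

/-- Affine-linear functions `root i` and vectors `coroot i` on a rational vector space `V`, whose
Cartan integers (up to sign) match the bonds of the Coxeter matrix `M`, all of order `2`, `3`
or `4`. -/
structure AffineRootDatum {B : Type*} (M : CoxeterMatrix B) (V : Type*) [AddCommGroup V]
    [Module ℚ V] where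
  /-- The affine-linear functions whose zero sets are the walls. -/
  root : B → V → ℚ
  /-- The directions of the reflections. -/
  coroot : B → V
  /-- The negatives of the Cartan integers. -/
  cartan : B → B → ℚ
  root_add_smul : ∀ i j x t, root i (x + t • coroot j) = root i x + t * cartan i j
  cartan_self : ∀ i, cartan i i = -2
  bond : ∀ i j, i ≠ j →
    (M i j = 2 ∧ cartan i j = 0 ∧ cartan j i = 0) ∨
    (M i j = 3 ∧ cartan i j = 1 ∧ cartan j i = 1) ∨
    (M i j = 4 ∧ 0 < cartan i j ∧ cartan i j * cartan j i = 2)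

namespace AffineRootDatum

variable {B V : Type*} {M : CoxeterMatrix B} [AddCommGroup V] [Module ℚ V]
  (D : AffineRootDatum M V)

/-- The reflection in the wall of index `i`, as a function. -/
def reflFun (i : B) (x : V) : V := x + D.root i x • D.coroot i

theorem root_reflFun (i j : B) (x : V) :
    D.root i (D.reflFun j x) = D.root i x + D.root j x * D.cartan i j :=
  D.root_add_smul i j x _

theorem root_reflFun_self (i : B) (x : V) : D.root i (D.reflFun i x) = -D.root i x := by
  rw [root_reflFun, cartan_self]; ring

theorem reflFun_involutive (i : B) : Function.Involutive (D.reflFun i) := by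
  intro x
  conv_lhs => rw [reflFun]
  rw [root_reflFun_self, reflFun]
  module

/-- The reflection in the wall of index `i`. -/
def refl (i : B) : Equiv.Perm V := (D.reflFun_involutive i).toPerm

theorem refl_apply (i : B) (x : V) : D.refl i x = x + D.root i x • D.coroot i := rfl

theorem root_refl (i j : B) (x : V) :
    D.root i (D.refl j x) = D.root i x + D.root j x * D.cartan i j :=
  D.root_reflFun i j x

theorem root_refl_self (i : B) (x : V) : D.root i (D.refl i x) = -D.root i x :=
  D.root_reflFun_self i x

theorem refl_mul_self (i : B) : D.refl i * D.refl i = 1 :=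
  Equiv.ext (D.reflFun_involutive i)

theorem isLiftable_refl : M.IsLiftable D.refl := by
  intro i j
  by_cases hij : i = j
  · subst hij
    rw [D.refl_mul_self, one_pow]
  have hi := D.refl_mul_self i
  have hj := D.refl_mul_self j
  have key : ∀ {G : Type _} [Group G] (a b : G), a * a = 1 → b * b = 1 →
      (a * b = b * a → (a * b) ^ 2 = 1) ∧ (a * b * a = b * a * b → (a * b) ^ 3 = 1) ∧
      (a * b * a * b = b * a * b * a → (a * b) ^ 4 = 1) := by
    intro G _ a b ha hb
    refine ⟨fun h => ?_, fun h => ?_, fun h => ?_⟩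
    · calc (a * b) ^ 2 = (a * b) * (a * b) := pow_two _
        _ = (a * b) * (b * a) := by rw [h]
        _ = a * (b * b) * a := by group
        _ = 1 := by rw [hb, mul_one, ha]
    · calc (a * b) ^ 3 = (a * b * a) * (b * a * b) := by simp only [pow_succ, pow_zero]; group
        _ = (a * b * a) * (a * b * a) := by rw [h]
        _ = a * (b * (a * a) * b) * a := by simp only [mul_assoc]
        _ = 1 := by rw [ha, mul_one, hb, mul_one, ha]
    · calc (a * b) ^ 4 = (a * b * a * b) * (a * b * a * b) := by
            simp only [pow_succ, pow_zero]; group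
        _ = (a * b * a * b) * (b * a * b * a) := by rw [h]
        _ = a * (b * (a * (b * b) * a) * b) * a := by simp only [mul_assoc]
        _ = 1 := by rw [hb, mul_one, ha, mul_one, hb, mul_one, ha]
  obtain ⟨key2, key3, key4⟩ := key _ _ hi hj
  rcases D.bond i j hij with ⟨hM, h1, h2⟩ | ⟨hM, h1, h2⟩ | ⟨hM, h0, h1⟩
  · rw [hM]
    refine key2 (Equiv.ext fun x => ?_)
    simp only [Equiv.Perm.mul_apply]
    simp only [D.refl_apply, D.root_add_smul, h1, h2]
    module
  · rw [hM]
    refine key3 (Equiv.ext fun x => ?_)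
    simp only [Equiv.Perm.mul_apply]
    simp only [D.refl_apply, D.root_add_smul, D.cartan_self, h1, h2]
    module
  · rw [hM]
    refine key4 (Equiv.ext fun x => ?_)
    simp only [Equiv.Perm.mul_apply]
    simp only [D.refl_apply, D.root_add_smul, D.cartan_self]
    match_scalars
    · ring
    · linear_combination (-D.root i x * D.cartan j i) * h1
    · linear_combination (D.root j x * D.cartan i j) * h1

/-- The action of the Coxeter group by affine reflections. -/
def rep : M.Group →* Equiv.Perm V := M.toCoxeterSystem.lift ⟨D.refl, D.isLiftable_refl⟩

theorem rep_simple (i : B) : D.rep (M.simple i) = D.refl i :=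
  M.toCoxeterSystem.lift_apply_simple D.isLiftable_refl i

/-- If `p` lies in the open fundamental chamber and `ℓ w < ℓ (sᵢ w)`, then `w p` lies on the
positive side of the wall of index `i`. -/
theorem root_rep_pos {p : V} (hp : ∀ i, 0 < D.root i p) (w : M.Group) (i : B)
    (hi : ¬ M.toCoxeterSystem.IsLeftDescent w i) : 0 < D.root i (D.rep w p) := by
  induction hl : M.toCoxeterSystem.length w using Nat.strong_induction_on generalizing w i with
  | _ l ih =>
  subst hl
  set cs := M.toCoxeterSystem with hcs
  by_cases hw : w = 1
  · subst hw; simpa using hp i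
  obtain ⟨j, hj⟩ := cs.exists_leftDescent_of_ne_one hw
  have hij : i ≠ j := by rintro rfl; exact hi hj
  have hrep : ∀ k u, D.rep u p = D.refl k (D.rep (cs.simple k * u) p) := by
    intro k u
    rw [map_mul, hcs, CoxeterMatrix.toCoxeterSystem_simple, rep_simple, Equiv.Perm.mul_apply,
      ← Equiv.Perm.mul_apply (D.refl k), refl_mul_self, Equiv.Perm.one_apply]
  have asc : ∀ k u, cs.IsLeftDescent u k → ¬ cs.IsLeftDescent (cs.simple k * u) k := by
    intro k u h
    exact cs.isLeftDescent_iff_not_isLeftDescent_mul.1 h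
  have hle : ∀ k u, cs.length (cs.simple k * u) ≤ cs.length u + 1 := by
    intro k u
    have := cs.length_mul_le (cs.simple k) u
    rw [cs.length_simple] at this
    omega
  have hi' := cs.not_isLeftDescent_iff.1 hi
  have hl1 := cs.isLeftDescent_iff.1 hj
  have hc0 : 0 ≤ D.cartan i j := by
    rcases D.bond i j hij with ⟨_, h, _⟩ | ⟨_, h, _⟩ | ⟨_, h, _⟩
    · rw [h]
    · rw [h]; exact zero_le_one
    · exact h.le
  set w1 := cs.simple j * w with hw1
  have pj1 := ih _ (by omega) w1 j (asc _ _ hj) rfl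
  by_cases d1 : cs.IsLeftDescent w1 i
  swap
  · have pi1 := ih _ (by omega) w1 i d1 rfl
    rw [hrep j w, D.root_refl]
    exact add_pos_of_pos_of_nonneg pi1 (mul_nonneg pj1.le hc0)
  have hl2 := cs.isLeftDescent_iff.1 d1
  set w2 := cs.simple i * w1 with hw2
  have e1 : w = cs.simple j * w1 := by simp [hw1]
  have e2 : w1 = cs.simple i * w2 := by simp [hw2]
  have pi2 := ih _ (by omega) w2 i (asc _ _ d1) rfl
  have hpow := cs.simple_mul_simple_pow i j
  rcases D.bond i j hij with ⟨hM, c1, c2⟩ | ⟨hM, c1, c2⟩ | ⟨hM, c0, c1⟩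
  · exfalso
    have comm : cs.simple i * cs.simple j = cs.simple j * cs.simple i := by
      rw [hM] at hpow
      rw [eq_inv_of_mul_eq_one_left ((pow_two _).symm.trans hpow), mul_inv_rev,
        cs.inv_simple, cs.inv_simple]
    have := hle j w2
    have e : cs.simple i * w = cs.simple j * w2 := by
      rw [e1, hw2, ← mul_assoc, comm, mul_assoc]
    rw [e] at hi'
    omega
  · by_cases d2 : cs.IsLeftDescent w2 j
    · exfalso
      have hl3 := cs.isLeftDescent_iff.1 d2
      have braid : cs.simple i * cs.simple j * cs.simple i =
          cs.simple j * cs.simple i * cs.simple j := by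
        rw [hM] at hpow
        have : cs.simple i * cs.simple j * cs.simple i *
            (cs.simple j * cs.simple i * cs.simple j) = 1 := by
          rw [← hpow]; simp only [pow_succ, pow_zero, one_mul, mul_assoc]
        rw [eq_inv_of_mul_eq_one_left this]
        simp only [mul_inv_rev, cs.inv_simple, mul_assoc]
      have e : cs.simple i * w = cs.simple j * (cs.simple i * (cs.simple j * w2)) := by
        rw [e1, e2]
        simp only [← mul_assoc, braid]
      have h1 := hle j (cs.simple i * (cs.simple j * w2))
      have h2 := hle i (cs.simple j * w2)
      rw [e] at hi'
      omega
    · have pj2 := ih _ (by omega) w2 j d2 rfl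
      rw [hrep j w, ← hw1, hrep i w1, ← hw2]
      simp only [D.root_refl, D.cartan_self, c1, c2]
      linarith
  · by_cases d2 : cs.IsLeftDescent w2 j
    · have hl3 := cs.isLeftDescent_iff.1 d2
      set w3 := cs.simple j * w2 with hw3
      have e3 : w2 = cs.simple j * w3 := by simp [hw3]
      by_cases d3 : cs.IsLeftDescent w3 i
      · exfalso
        have hl4 := cs.isLeftDescent_iff.1 d3
        have braid : cs.simple i * cs.simple j * cs.simple i * cs.simple j =
            cs.simple j * cs.simple i * cs.simple j * cs.simple i := by
          rw [hM] at hpow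
          have : cs.simple i * cs.simple j * cs.simple i * cs.simple j *
              (cs.simple i * cs.simple j * cs.simple i * cs.simple j) = 1 := by
            rw [← hpow]; simp only [pow_succ, pow_zero, one_mul, mul_assoc]
          rw [eq_inv_of_mul_eq_one_left this]
          simp only [mul_inv_rev, cs.inv_simple, mul_assoc]
        have e : cs.simple i * w =
            cs.simple j * (cs.simple i * (cs.simple j * (cs.simple i * w3))) := by
          rw [e1, e2, e3]
          simp only [← mul_assoc, braid]
        have h1 := hle j (cs.simple i * (cs.simple j * (cs.simple i * w3)))
        have h2 := hle i (cs.simple j * (cs.simple i * w3))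
        have h3 := hle j (cs.simple i * w3)
        rw [e] at hi'
        omega
      · have pi3 := ih _ (by omega) w3 i d3 rfl
        rw [hrep j w, ← hw1, hrep i w1, ← hw2, hrep j w2, ← hw3]
        simp only [D.root_refl, D.cartan_self]
        linear_combination pi3 -
          (D.root i (D.rep w3 p) + D.root j (D.rep w3 p) * D.cartan i j) * c1
    · have pj2 := ih _ (by omega) w2 j d2 rfl
      have := mul_pos pj2 c0
      rw [hrep j w, ← hw1, hrep i w1, ← hw2]
      simp only [D.root_refl, D.cartan_self]
      linear_combination pi2 + this - D.root i (D.rep w2 p) * c1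

/-- The action by affine reflections is faithful as soon as the open fundamental chamber is
nonempty. -/
theorem rep_injective {p : V} (hp : ∀ i, 0 < D.root i p) : Function.Injective D.rep := by
  rw [injective_iff_map_eq_one]
  intro w hw
  by_contra hne
  obtain ⟨i, hi⟩ := M.toCoxeterSystem.exists_leftDescent_of_ne_one hne
  have h := D.root_rep_pos hp _ i
    (M.toCoxeterSystem.isLeftDescent_iff_not_isLeftDescent_mul.1 hi)
  rw [map_mul, hw, CoxeterMatrix.toCoxeterSystem_simple, rep_simple, mul_one, root_refl_self] at h
  linarith [hp i]

end AffineRootDatum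

/-- The walls of the standard alcove `0 < x₀ < ⋯ < x_{m-1} < 1/2` of type `C̃ₘ`. -/
def ctildeRoot (m i : ℕ) (x : ℕ → ℚ) : ℚ :=
  if i = 0 then x 0 else if i = m then 1 - 2 * x (m - 1) else x i - x (i - 1)

/-- The reflection directions of type `C̃ₘ`. -/
def ctildeCoroot (m i k : ℕ) : ℚ :=
  if i = 0 then (if k = 0 then -2 else 0)
  else if i = m then (if k = m - 1 then 1 else 0)
  else if k = i - 1 then 1 else if k = i then -1 else 0

/-- The affine root datum of type `C̃ₘ`, acting on the space of all rational sequences. -/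
def ctildeDatum (m : ℕ) (hm : 2 ≤ m) : AffineRootDatum (ctildeM m) (ℕ → ℚ) where
  root i := ctildeRoot m i
  coroot i := ctildeCoroot m i
  cartan i j := ctildeRoot m i (ctildeCoroot m j) - ctildeRoot m i 0
  root_add_smul i j x t := by
    simp only [ctildeRoot, Pi.add_apply, Pi.smul_apply, Pi.zero_apply, smul_eq_mul]
    split_ifs <;> ring
  cartan_self i := by
    simp only [ctildeRoot, ctildeCoroot, Pi.zero_apply]
    grind
  bond i j hij := by
    have hij' : (i : ℕ) ≠ j := fun h => hij (Fin.ext h)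
    have hi := i.isLt
    have hj := j.isLt
    change (Matrix.of _ i j = 2 ∧ _) ∨ (Matrix.of _ i j = 3 ∧ _) ∨ (Matrix.of _ i j = 4 ∧ _)
    simp only [Matrix.of_apply, if_neg hij]
    simp only [ctildeRoot, ctildeCoroot, Pi.zero_apply]
    generalize (i : ℕ) = a at *
    generalize (j : ℕ) = b at *
    clear hij
    by_cases far : a + 1 < b ∨ b + 1 < a
    · exact Or.inl ⟨if_pos far, by grind, by grind⟩
    rw [if_neg far]
    by_cases ends : a = 0 ∨ b = 0 ∨ a = m ∨ b = m
    · refine Or.inr (Or.inr ⟨if_pos ends, by grind, ?_⟩)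
      obtain rfl | rfl : b = a + 1 ∨ a = b + 1 := by omega
      · grind
      · grind
    · exact Or.inr (Or.inl ⟨if_neg ends, by grind, by grind⟩)

theorem ctildeDatum_root_pos (m : ℕ) (hm : 2 ≤ m) (i : Fin (m + 1)) :
    0 < (ctildeDatum m hm).root i fun k => 1 / 2 - 1 / ((k : ℚ) + 3) := by
  change 0 < ctildeRoot m i _
  simp only [ctildeRoot]
  split_ifs with h h'
  · norm_num
  · have : (0 : ℚ) < 1 / (((m - 1 : ℕ) : ℚ) + 3) := by positivity
    linarith
  · obtain ⟨k, hk⟩ := Nat.exists_eq_succ_of_ne_zero h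
    rw [hk]
    have : 1 / (((k + 1 : ℕ) : ℚ) + 3) < 1 / ((k : ℚ) + 3) := by
      apply one_div_lt_one_div_of_lt (by positivity)
      push_cast
      linarith
    simp only [Nat.succ_eq_add_one, Nat.add_sub_cancel]
    linarith

theorem ctildeDatum_refl_apply (m : ℕ) (hm : 2 ≤ m) (i : Fin (m + 1)) (x : ℕ → ℚ) (k : ℕ) :
    (ctildeDatum m hm).refl i x k = x k + ctildeRoot m i x * ctildeCoroot m i k := rfl

theorem ctildeDatum_refl_succ (n : ℕ) (hn : 2 ≤ n) (hn' : 2 ≤ n + 1) (i : Fin (n + 1))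
    (j : Fin (n + 2)) (hij : (j : ℕ) = i) (hi : (i : ℕ) < n) :
    (ctildeDatum (n + 1) hn').refl j = (ctildeDatum n hn).refl i := by
  ext x k
  have h1 : (i : ℕ) ≠ n := by omega
  have h2 : (i : ℕ) ≠ n + 1 := by omega
  simp only [ctildeDatum_refl_apply, ctildeRoot, ctildeCoroot, hij, h1, h2, if_false]

theorem ctildeDatum_refl_last (n : ℕ) (hn : 2 ≤ n) (hn' : 2 ≤ n + 1) (i : Fin (n + 1))
    (j k : Fin (n + 2)) (hi : (i : ℕ) = n) (hj : (j : ℕ) = n) (hk : (k : ℕ) = n + 1) :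
    (ctildeDatum (n + 1) hn').refl j * (ctildeDatum (n + 1) hn').refl k *
      (ctildeDatum (n + 1) hn').refl j = (ctildeDatum n hn).refl i := by
  have hσ : ∀ x l, (ctildeDatum (n + 1) hn').refl j x l =
      if l = n then x (n - 1) else if l = n - 1 then x n else x l := by
    intro x l
    simp only [ctildeDatum_refl_apply, ctildeRoot, ctildeCoroot, hj]
    grind
  have ht : ∀ x l, (ctildeDatum (n + 1) hn').refl k x l = if l = n then 1 - x n else x l := by
    intro x l
    simp only [ctildeDatum_refl_apply, ctildeRoot, ctildeCoroot, hk]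
    grind
  have ht' : ∀ x l, (ctildeDatum n hn).refl i x l =
      if l = n - 1 then 1 - x (n - 1) else x l := by
    intro x l
    simp only [ctildeDatum_refl_apply, ctildeRoot, ctildeCoroot, hi]
    grind
  ext x l
  simp only [Equiv.Perm.mul_apply, hσ, ht, ht']
  grind

/-- For every `n ≥ 2` there is a group homomorphism
`Pₙ : W(C̃ₙ) → W(C̃ₙ₊₁)` determined on Coxeter generators by `σᵢ ↦ σᵢ` for `0 ≤ i ≤ n-1`
and `tₙ ↦ σₙ tₙ₊₁ σₙ`, and this homomorphism is injective. -/
theorem exists_injective_ctilde_tower_hom (n : ℕ) (hn : 2 ≤ n) :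
    ∃ P : (ctildeM n).Group →* (ctildeM (n+1)).Group,
      (∀ i : Fin (n+1), (i : ℕ) ≤ n - 1 →
        P ((ctildeM n).simple i) = (ctildeM (n+1)).simple ⟨i, by omega⟩) ∧
      P ((ctildeM n).simple ⟨n, by omega⟩) =
        (ctildeM (n+1)).simple ⟨n, by omega⟩ * (ctildeM (n+1)).simple ⟨n+1, by omega⟩ *
          (ctildeM (n+1)).simple ⟨n, by omega⟩ ∧
      Function.Injective P := by
  set ρ := (ctildeDatum n hn).rep with hρ
  set ρ' := (ctildeDatum (n + 1) (by omega)).rep with hρ'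
  have inj : Function.Injective ρ :=
    AffineRootDatum.rep_injective _ (ctildeDatum_root_pos n hn)
  have inj' : Function.Injective ρ' :=
    AffineRootDatum.rep_injective _ (ctildeDatum_root_pos (n + 1) (by omega))
  have img_σ : ∀ i : Fin (n + 1), (i : ℕ) < n →
      ρ' ((ctildeM (n+1)).simple ⟨i, by omega⟩) = ρ ((ctildeM n).simple i) := by
    intro i hi
    rw [hρ, hρ', AffineRootDatum.rep_simple, AffineRootDatum.rep_simple]
    exact ctildeDatum_refl_succ n hn _ i _ rfl hi
  have img_t : ρ' ((ctildeM (n+1)).simple ⟨n, by omega⟩ *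
      (ctildeM (n+1)).simple ⟨n+1, by omega⟩ * (ctildeM (n+1)).simple ⟨n, by omega⟩) =
      ρ ((ctildeM n).simple ⟨n, by omega⟩) := by
    simp only [hρ, hρ', map_mul, AffineRootDatum.rep_simple]
    exact ctildeDatum_refl_last n hn _ _ _ _ rfl rfl rfl
  have mem : ∀ w, ρ w ∈ ρ'.range := by
    intro w
    induction w using (ctildeM n).toCoxeterSystem.simple_induction with
    | simple i =>
      rw [CoxeterMatrix.toCoxeterSystem_simple]
      by_cases hi : (i : ℕ) < n
      · exact ⟨_, img_σ i hi⟩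
      · have hin : i = ⟨n, by omega⟩ := Fin.ext (by have := i.isLt; simp only; omega)
        rw [hin]
        exact ⟨_, img_t⟩
    | one => rw [map_one]; exact one_mem _
    | mul w w' h h' => rw [map_mul]; exact mul_mem h h'
  let P : (ctildeM n).Group →* (ctildeM (n+1)).Group :=
    (MonoidHom.ofInjective inj').symm.toMonoidHom.comp (ρ.codRestrict ρ'.range mem)
  have hP : ∀ w, ρ' (P w) = ρ w := fun w =>
    congrArg Subtype.val ((MonoidHom.ofInjective inj').apply_symm_apply ⟨ρ w, mem w⟩)
  refine ⟨P, fun i hi => inj' ?_, inj' ?_, fun a b hab => inj ?_⟩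
  · rw [hP, img_σ i (by omega)]
  · rw [hP, img_t]
  · rw [← hP, ← hP, hab]
end

section
/- For every n ≥ 2 the diagram commutes: L_n ∘ i_n = i_{n+1} ∘ P_n as homomorphisms from W(C̃_n) to W(Ã_{2n+1}), where L_n = φ_{2n+1} ∘ I_{2n+1} ∘ I_{2n}. -/
open List

/-- The Coxeter matrix of affine type Ã with `c` generators arranged in a cycle
(intended for `c ≥ 3`): cyclically adjacent generators have bond order `3` and all other
pairs commute.  With the paper's notation, `(atildeM m).Group` is `W(Ã_{m-1})`, where the
generator of index `k ≤ m-2` is `s_{k+1}` and the generator of index `m-1` is `aₘ`. -/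
def atildeM (c : ℕ) : CoxeterMatrix (Fin c) where
  M := Matrix.of fun i j =>
    if i = j then 1
    else if ((i:ℕ)+1) % c = j ∨ ((j:ℕ)+1) % c = i then 3
    else 2
  isSymm := by
    unfold Matrix.IsSymm
    ext i j
    simp only [Matrix.transpose_apply, Matrix.of_apply]
    rcases eq_or_ne i j with h | h
    · simp [h]
    · rw [if_neg h, if_neg (Ne.symm h)]
      exact if_congr (by tauto) rfl rfl
  diagonal := fun i => by simp
  off_diagonal := fun i i' h => by
    simp only [Matrix.of_apply, if_neg h]
    split <;> simp

namespace CoxeterMatrix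

variable {B : Type*} (M : CoxeterMatrix B)

lemma inv_simple (i : B) : (M.simple i)⁻¹ = M.simple i :=
  M.toCoxeterSystem.inv_simple i

lemma simple_mul_simple_pow (i j : B) : (M.simple i * M.simple j) ^ M i j = 1 :=
  M.toCoxeterSystem.simple_mul_simple_pow i j

variable {M}

lemma commute_simple {i j : B} (h : M i j = 2) : Commute (M.simple i) (M.simple j) := by
  have hpow := M.simple_mul_simple_pow i j
  rw [h, pow_two] at hpow
  simpa [commute_iff_eq, inv_simple] using eq_inv_of_mul_eq_one_left hpow

lemma simple_braid {i j : B} (h : M i j = 3) :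
    M.simple i * M.simple j * M.simple i = M.simple j * M.simple i * M.simple j := by
  have hpow := M.simple_mul_simple_pow i j
  rw [h, pow_succ, pow_two] at hpow
  have hpow' : (M.simple i * M.simple j * M.simple i) *
      (M.simple j * M.simple i * M.simple j) = 1 := by
    simpa only [mul_assoc] using hpow
  simpa [inv_simple, mul_assoc] using eq_inv_of_mul_eq_one_left hpow'

end CoxeterMatrix

lemma atildeM_eq_two {c : ℕ} {i j : Fin c} (hne : i ≠ j)
    (hij : ((i : ℕ) + 1) % c ≠ j) (hji : ((j : ℕ) + 1) % c ≠ i) : atildeM c i j = 2 := by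
  simp [atildeM, hne, hij, hji]

lemma atildeM_eq_three {c : ℕ} {i j : Fin c} (hne : i ≠ j)
    (hij : ((i : ℕ) + 1) % c = j) : atildeM c i j = 3 := by
  simp [atildeM, hne, hij]

/-- Conjugating the braid relation `a b a = b a b` by an element commuting with `b`
is the same as conjugating `a` by the product of that element with `b`. -/
lemma Commute.conj_braid {G : Type*} [Semigroup G] {a b d : G} (hbd : Commute b d)
    (hab : a * b * a = b * a * b) :
    d * (a * b * a) * d = (b * d) * a * (b * d) := by
  calc d * (a * b * a) * d = (d * b) * a * (b * d) := by simp only [hab, mul_assoc]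
    _ = (b * d) * a * (b * d) := by rw [hbd.eq]

/-- For every `n ≥ 2` the diagram commutes: `Lₙ ∘ iₙ = iₙ₊₁ ∘ Pₙ` as
homomorphisms from `W(C̃ₙ)` to `W(Ã₂ₙ₊₁)`, where `Lₙ = φ₂ₙ₊₁ ∘ I₂ₙ₊₁ ∘ I₂ₙ`.
Here all the homomorphisms are specified by their values on the Coxeter generators. -/
theorem ctilde_atilde_diagram_commutes (n : ℕ) (hn : 2 ≤ n)
    -- `Pₙ : W(C̃ₙ) → W(C̃ₙ₊₁)`, `σᵢ ↦ σᵢ`, `tₙ ↦ σₙ tₙ₊₁ σₙ`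
    (P : (ctildeM n).Group →* (ctildeM (n+1)).Group)
    (hP1 : ∀ i : Fin (n+1), (i:ℕ) ≤ n - 1 →
      P ((ctildeM n).simple i) = (ctildeM (n+1)).simple ⟨i, by omega⟩)
    (hP2 : P ((ctildeM n).simple ⟨n, by omega⟩) =
      (ctildeM (n+1)).simple ⟨n, by omega⟩ * (ctildeM (n+1)).simple ⟨n+1, by omega⟩ *
        (ctildeM (n+1)).simple ⟨n, by omega⟩)
    -- `iₙ : W(C̃ₙ) → W(Ã₂ₙ₋₁)`, `σᵢ ↦ s_{n-i} s_{n+i}`, `t = σ₀ ↦ sₙ`, `tₙ ↦ a₂ₙ`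
    (iN : (ctildeM n).Group →* (atildeM (2*n)).Group)
    (hiN1 : ∀ i : Fin (n+1), 1 ≤ (i:ℕ) → (i:ℕ) ≤ n - 1 →
      iN ((ctildeM n).simple i) =
        (atildeM (2*n)).simple ⟨n - i - 1, by omega⟩ *
          (atildeM (2*n)).simple ⟨n + i - 1, by omega⟩)
    (hiN2 : iN ((ctildeM n).simple ⟨0, by omega⟩) = (atildeM (2*n)).simple ⟨n - 1, by omega⟩)
    (hiN3 : iN ((ctildeM n).simple ⟨n, by omega⟩) = (atildeM (2*n)).simple ⟨2*n - 1, by omega⟩)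
    -- `iₙ₊₁ : W(C̃ₙ₊₁) → W(Ã₂ₙ₊₁)`, `σᵢ ↦ s_{n+1-i} s_{n+1+i}`, `σ₀ ↦ sₙ₊₁`, `tₙ₊₁ ↦ a₂ₙ₊₂`
    (iN1 : (ctildeM (n+1)).Group →* (atildeM (2*n+2)).Group)
    (hiN11 : ∀ i : Fin (n+2), 1 ≤ (i:ℕ) → (i:ℕ) ≤ n →
      iN1 ((ctildeM (n+1)).simple i) =
        (atildeM (2*n+2)).simple ⟨n - i, by omega⟩ *
          (atildeM (2*n+2)).simple ⟨n + i, by omega⟩)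
    (hiN12 : iN1 ((ctildeM (n+1)).simple ⟨0, by omega⟩) = (atildeM (2*n+2)).simple ⟨n, by omega⟩)
    (hiN13 : iN1 ((ctildeM (n+1)).simple ⟨n+1, by omega⟩) =
      (atildeM (2*n+2)).simple ⟨2*n+1, by omega⟩)
    -- `I₂ₙ : W(Ã₂ₙ₋₁) → W(Ã₂ₙ)`, `sᵢ ↦ sᵢ`, `a₂ₙ ↦ s₂ₙ a₂ₙ₊₁ s₂ₙ`
    (I2n : (atildeM (2*n)).Group →* (atildeM (2*n+1)).Group)
    (hI2n1 : ∀ k : Fin (2*n), (k:ℕ) ≤ 2*n - 2 →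
      I2n ((atildeM (2*n)).simple k) = (atildeM (2*n+1)).simple ⟨k, by omega⟩)
    (hI2n2 : I2n ((atildeM (2*n)).simple ⟨2*n - 1, by omega⟩) =
      (atildeM (2*n+1)).simple ⟨2*n - 1, by omega⟩ * (atildeM (2*n+1)).simple ⟨2*n, by omega⟩ *
        (atildeM (2*n+1)).simple ⟨2*n - 1, by omega⟩)
    -- `I₂ₙ₊₁ : W(Ã₂ₙ) → W(Ã₂ₙ₊₁)`, `sᵢ ↦ sᵢ`, `a₂ₙ₊₁ ↦ s₂ₙ₊₁ a₂ₙ₊₂ s₂ₙ₊₁`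
    (I2n1 : (atildeM (2*n+1)).Group →* (atildeM (2*n+2)).Group)
    (hI2n11 : ∀ k : Fin (2*n+1), (k:ℕ) ≤ 2*n - 1 →
      I2n1 ((atildeM (2*n+1)).simple k) = (atildeM (2*n+2)).simple ⟨k, by omega⟩)
    (hI2n12 : I2n1 ((atildeM (2*n+1)).simple ⟨2*n, by omega⟩) =
      (atildeM (2*n+2)).simple ⟨2*n, by omega⟩ * (atildeM (2*n+2)).simple ⟨2*n+1, by omega⟩ *
        (atildeM (2*n+2)).simple ⟨2*n, by omega⟩)
    -- `φ₂ₙ₊₁`, the rotation automorphism of `W(Ã₂ₙ₊₁)`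
    (phi : (atildeM (2*n+2)).Group →* (atildeM (2*n+2)).Group)
    (hphi : ∀ k : Fin (2*n+2),
      phi ((atildeM (2*n+2)).simple k) =
        (atildeM (2*n+2)).simple ⟨((k:ℕ)+1) % (2*n+2), Nat.mod_lt _ (by omega)⟩) :
    ∀ w : (ctildeM n).Group, phi (I2n1 (I2n (iN w))) = iN1 (P w) := by
  suffices h : phi.comp (I2n1.comp (I2n.comp iN)) = iN1.comp P from
    fun w => DFunLike.congr_fun h w
  refine (ctildeM n).toCoxeterSystem.ext_simple fun i => ?_
  simp only [CoxeterMatrix.toCoxeterSystem_simple, MonoidHom.comp_apply]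
  have hL (k : ℕ) (hk : k ≤ 2 * n - 2) :
      phi (I2n1 (I2n ((atildeM (2*n)).simple ⟨k, by omega⟩))) =
        (atildeM (2*n+2)).simple ⟨k + 1, by omega⟩ := by
    rw [hI2n1 _ hk, hI2n11 _ (show k ≤ 2 * n - 1 by omega), hphi]
    simp only [Nat.mod_eq_of_lt (show k + 1 < 2 * n + 2 by omega)]
  obtain ⟨i, hi⟩ := i
  obtain rfl | hi0 := Nat.eq_zero_or_pos i
  · rw [hiN2, hP1 _ (Nat.zero_le _), hiN12, hL _ (by omega)]
    simp only [Nat.sub_add_cancel (show 1 ≤ n by omega)]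
  obtain hin | hin := Nat.lt_or_ge i n
  · have hi' : i ≤ n - 1 := by omega
    rw [hiN1 ⟨i, hi⟩ hi0 hi', hP1 ⟨i, hi⟩ hi', hiN11 ⟨i, by omega⟩ hi0 hin.le]
    simp only [map_mul]
    rw [hL _ (by omega), hL _ (by omega)]
    simp only [Nat.sub_add_cancel (show 1 ≤ n - i by omega),
      Nat.sub_add_cancel (show 1 ≤ n + i by omega)]
  · obtain rfl : i = n := by omega
    rw [hiN3, hP2, hI2n2]
    simp only [map_mul]
    rw [hI2n11 ⟨2 * i - 1, by omega⟩ le_rfl, hI2n12, hiN13,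
      hiN11 ⟨i, by omega⟩ hi0 le_rfl]
    simp only [map_mul, hphi, Nat.mod_self, Nat.sub_self,
      Nat.sub_add_cancel (show 1 ≤ 2 * i by omega), ← two_mul,
      Nat.mod_eq_of_lt (show 2 * i < 2 * i + 2 by omega),
      Nat.mod_eq_of_lt (show 2 * i + 1 < 2 * i + 2 by omega)]
    refine Commute.conj_braid (CoxeterMatrix.commute_simple (atildeM_eq_two ?_ ?_ ?_))
      (CoxeterMatrix.simple_braid (atildeM_eq_three ?_ ?_))
    · simp only [ne_eq, Fin.mk.injEq]; omega
    · rw [Nat.mod_eq_of_lt] <;> simp only <;> omega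
    · rw [Nat.mod_eq_of_lt] <;> simp only <;> omega
    · simp only [ne_eq, Fin.mk.injEq]; omega
    · exact Nat.mod_self _
end
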